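/- arXiv:2004.01156 — 6 statements merged into one kernel-verified Lean document; each statement's English description precedes it below -/
import Mathlib

section
/- Let S be a finite set of size n and let (h(x))_{x∈S} be a pairwise independent family of random variables, each uniformly distributed on (0,1], such that almost surely all values h(x), x ∈ S, are distinct. Let 1 ≤ k ≤ n, let h_(k) be the k-th smallest hash value of S, and let n̂ = k/h_(k). Then for every 0 < ε ≤ 1 with k/((1−ε)n) ≤ 1, Pr[|n̂ − n| > ε·n] ≤ 2/(k·ε²). -/
open MeasureTheory ProbabilityTheory

/-- The `k`-th smallest value among `{h x : x ∈ S}` (for `1 ≤ k ≤ |S|` and `h`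
injective on `S`): the `(k-1)`-st entry of the increasingly sorted list of hash values. -/
noncomputable def kthSmallest {α : Type*} (S : Finset α) (h : α → ℝ) (k : ℕ) : ℝ :=
  ((S.image h).sort (· ≤ ·)).getD (k - 1) 0

/-- The `k`-th smallest value is at most `t` exactly when at least `k` values are at most `t`. -/
theorem kthSmallest_le_iff {α : Type*} (S : Finset α) (h : α → ℝ) (hinj : Set.InjOn h S)
    {k : ℕ} (hk1 : 1 ≤ k) (hkn : k ≤ S.card) (t : ℝ) :
    kthSmallest S h k ≤ t ↔ k ≤ (S.filter fun x => h x ≤ t).card := by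
  classical
  have hcard : (S.image h).card = S.card := Finset.card_image_of_injOn hinj
  have hlt : k - 1 < S.card := by omega
  set e := (S.image h).orderEmbOfFin hcard with he
  have hkth : kthSmallest S h k = e ⟨k - 1, hlt⟩ := by
    rw [kthSmallest, he, Finset.orderEmbOfFin_apply, List.getD_eq_getElem]
    rfl
  have hcount : (S.filter fun x => h x ≤ t).card
      = (Finset.univ.filter fun i => e i ≤ t).card := by
    have himage : (S.filter fun x => h x ≤ t).image h
        = (Finset.univ.filter fun i => e i ≤ t).image e := by
      have hrange : S.image h = Finset.univ.image e := by
        rw [he, Finset.image_orderEmbOfFin_univ]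
      rw [← Finset.filter_image (p := fun y => y ≤ t),
        ← Finset.filter_image (p := fun y => y ≤ t), hrange]
    rw [← Finset.card_image_of_injective _ e.injective, ← himage, Finset.card_image_of_injOn]
    exact hinj.mono fun x hx => (Finset.mem_filter.1 hx).1
  rw [hkth, hcount]
  constructor
  · intro hle
    have hsub : Finset.Iic (⟨k - 1, hlt⟩ : Fin S.card)
        ⊆ Finset.univ.filter fun i => e i ≤ t := fun i hi => by
      simpa using (e.monotone (Finset.mem_Iic.1 hi)).trans hle
    have := Finset.card_le_card hsub
    rw [Fin.card_Iic] at this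
    simp only at this
    omega
  · intro hle
    by_contra! hgt
    have hsub : (Finset.univ.filter fun i => e i ≤ t)
        ⊆ Finset.Iio (⟨k - 1, hlt⟩ : Fin S.card) := fun i hi => by
      rw [Finset.mem_Iio]
      exact e.lt_iff_lt.1 ((Finset.mem_filter.1 hi).2.trans_lt hgt)
    have := Finset.card_le_card hsub
    rw [Fin.card_Iio] at this
    simp only at this
    omega

theorem kthSmallest_mem_image {α : Type*} (S : Finset α) (h : α → ℝ) (hinj : Set.InjOn h S)
    {k : ℕ} (hk1 : 1 ≤ k) (hkn : k ≤ S.card) : ∃ x ∈ S, h x = kthSmallest S h k := by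
  classical
  have hlen : k - 1 < ((S.image h).sort (· ≤ ·)).length := by
    rw [Finset.length_sort, Finset.card_image_of_injOn hinj]
    omega
  rw [kthSmallest, List.getD_eq_getElem _ _ hlen]
  exact Finset.mem_image.1 ((Finset.mem_sort _).1 (List.getElem_mem hlen))

/-- Chebyshev's inequality for the number of hash values that are at most `t`. -/
theorem measure_le_abs_card_filter_sub_le {Ω : Type*} [MeasurableSpace Ω] (μ : Measure Ω)
    [IsProbabilityMeasure μ] {α : Type*} (S : Finset α) (h : α → Ω → ℝ)
    (hmeas : ∀ x ∈ S, Measurable (h x))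
    (hunif : ∀ x ∈ S, Measure.map (h x) μ = volume.restrict (Set.Ioc (0 : ℝ) 1))
    (hindep : ∀ x ∈ S, ∀ y ∈ S, x ≠ y → IndepFun (h x) (h y) μ)
    {t c : ℝ} (ht0 : 0 ≤ t) (ht1 : t ≤ 1) (hc : 0 < c) :
    μ {ω | c ≤ |((S.filter fun x => h x ω ≤ t).card : ℝ) - S.card * t|}
      ≤ ENNReal.ofReal (S.card * t / c ^ 2) := by
  classical
  set g : ℝ → ℝ := (Set.Iic t).indicator 1 with hg
  have hgm : Measurable g := measurable_one.indicator measurableSet_Iic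
  have hgsq : g ^ 2 = g := by
    ext y
    by_cases hy : y ≤ t <;> simp [hg, Set.indicator, hy]
  set Y : α → Ω → ℝ := fun x => g ∘ h x with hY
  have hLp : ∀ x ∈ S, MemLp (Y x) 2 μ := fun x hx =>
    MemLp.of_bound (hgm.comp (hmeas x hx)).aestronglyMeasurable 1 <| by
      refine Filter.Eventually.of_forall fun ω => ?_
      by_cases hy : h x ω ≤ t <;> simp [hY, hg, Set.indicator, hy]
  have hmean : ∀ x ∈ S, ∫ ω, Y x ω ∂μ = t := fun x hx => by
    have hmap := integral_map (μ := μ) (hmeas x hx).aemeasurable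
      (f := g) hgm.aestronglyMeasurable
    simp only [hY, Function.comp_apply]
    rw [← hmap, hunif x hx, hg, integral_indicator_one measurableSet_Iic, measureReal_def,
      Measure.restrict_apply measurableSet_Iic,
      show Set.Iic t ∩ Set.Ioc (0 : ℝ) 1 = Set.Ioc 0 t by
        ext y; simp only [Set.mem_inter_iff, Set.mem_Iic, Set.mem_Ioc]
        constructor
        · rintro ⟨h1, h2, h3⟩; exact ⟨h2, h1⟩
        · rintro ⟨h1, h2⟩; exact ⟨h2, h1, h2.trans ht1⟩]
    simp [ht0]
  have hvar : ∀ x ∈ S, variance (Y x) μ ≤ t := fun x hx => by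
    refine (variance_le_expectation_sq (hLp x hx).1).trans_eq ?_
    rw [← hmean x hx]
    refine integral_congr_ae (Filter.Eventually.of_forall fun ω => ?_)
    exact congrFun hgsq (h x ω)
  have hcount : ∀ ω, ((S.filter fun x => h x ω ≤ t).card : ℝ) = (∑ x ∈ S, Y x) ω := fun ω => by
    simp [hY, hg, Set.indicator, Finset.sum_apply]
  have hsummean : ∫ ω, (∑ x ∈ S, Y x) ω ∂μ = S.card * t := by
    simp only [Finset.sum_apply]
    rw [integral_finsetSum _ fun x hx => (hLp x hx).integrable one_le_two,
      Finset.sum_congr rfl hmean]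
    simp
  have hsumvar : variance (∑ x ∈ S, Y x) μ ≤ S.card * t := by
    rw [IndepFun.variance_sum hLp fun x hx y hy hxy => (hindep x hx y hy hxy).comp hgm hgm]
    simpa using Finset.sum_le_sum hvar
  have hcheb := meas_ge_le_variance_div_sq (memLp_finsetSum' S hLp) hc
  rw [hsummean] at hcheb
  simp only [hcount]
  refine hcheb.trans (ENNReal.ofReal_le_ofReal ?_)
  gcongr

/-- For a pairwise independent family of hash values, each uniform
on `(0,1]`, almost surely pairwise distinct on `S` with `|S| = n`, the bottom-`k`
estimator `n̂ = k/h_(k)` satisfies, for `0 < ε ≤ 1` with `k/((1−ε)n) ≤ 1`,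
`Pr[|n̂ − n| > ε·n] ≤ 2/(k·ε²)`. -/
theorem stmt_5 {Ω : Type*} [MeasurableSpace Ω] (μpr : Measure Ω) [IsProbabilityMeasure μpr]
    {α : Type*} (S : Finset α) (h : α → Ω → ℝ)
    (hmeas : ∀ x ∈ S, Measurable (h x))
    (hunif : ∀ x ∈ S, Measure.map (h x) μpr = volume.restrict (Set.Ioc (0 : ℝ) 1))
    (hindep : ∀ x ∈ S, ∀ y ∈ S, x ≠ y → IndepFun (h x) (h y) μpr)
    (hdistinct : ∀ᵐ ω ∂μpr, Set.InjOn (fun x => h x ω) S)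
    (k : ℕ) (hk1 : 1 ≤ k) (hkn : k ≤ S.card)
    (ε : ℝ) (hε0 : 0 < ε) (hε1 : ε ≤ 1) (hp : (k : ℝ) / ((1 - ε) * S.card) ≤ 1) :
    μpr {ω | ε * S.card < |(k : ℝ) / kthSmallest S (fun x => h x ω) k - S.card|} ≤
      ENNReal.ofReal (2 / (k * ε ^ 2)) := by
  have hn : (0 : ℝ) < S.card := by exact_mod_cast hk1.trans hkn
  have hk : (0 : ℝ) < k := by exact_mod_cast hk1
  have hkn' : (k : ℝ) ≤ S.card := by exact_mod_cast hkn
  set n : ℝ := (S.card : ℝ) with hn_def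
  have hε1' : 0 < 1 + ε := by linarith
  have hpos : ∀ᵐ ω ∂μpr, ∀ x ∈ S, 0 < h x ω := by
    refine (Finset.eventually_all S).2 fun x hx => ?_
    have hmap : ∀ᵐ y ∂(Measure.map (h x) μpr), 0 < y := by
      rw [hunif x hx]
      exact (ae_restrict_mem measurableSet_Ioc).mono fun y hy => hy.1
    exact ae_of_ae_map (hmeas x hx).aemeasurable hmap
  set A : Set Ω := {ω | k * ε / (1 + ε) ≤
    |((S.filter fun x => h x ω ≤ k / ((1 + ε) * n)).card : ℝ) - n * (k / ((1 + ε) * n))|}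
    with hA_def
  have hA : μpr A ≤ ENNReal.ofReal ((1 + ε) / (k * ε ^ 2)) := by
    refine (measure_le_abs_card_filter_sub_le μpr S h hmeas hunif hindep
      (by positivity) ?_ (by positivity)).trans_eq ?_
    · rw [div_le_one (by positivity)]
      nlinarith
    · congr 1
      rw [← hn_def]
      field_simp
  set E : Set Ω := {ω | ε * n < |(k : ℝ) / kthSmallest S (fun x => h x ω) k - n|} with hE_def
  have hover : ∀ ω, Set.InjOn (fun x => h x ω) S → (∀ x ∈ S, 0 < h x ω) →
      ε * n < k / kthSmallest S (fun x => h x ω) k - n → ω ∈ A := fun ω hinj hω hlt => by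
    obtain ⟨x, hx, hxk⟩ := kthSmallest_mem_image S _ hinj hk1 hkn
    have hkpos : 0 < kthSmallest S (fun x => h x ω) k := hxk ▸ hω x hx
    have hle : kthSmallest S (fun x => h x ω) k ≤ k / ((1 + ε) * n) := by
      rw [le_div_iff₀ (by positivity)]
      have : (1 + ε) * n < k / kthSmallest S (fun x => h x ω) k := by linarith
      rw [lt_div_iff₀ hkpos] at this
      linarith
    have hcount : (k : ℝ) ≤ (S.filter fun x => h x ω ≤ k / ((1 + ε) * n)).card := by
      exact_mod_cast (kthSmallest_le_iff S _ hinj hk1 hkn _).1 hle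
    rw [hA_def, Set.mem_ofPred_eq]
    refine le_trans ?_ (le_abs_self _)
    have : (k : ℝ) * ε / (1 + ε) = k - n * (k / ((1 + ε) * n)) := by
      field_simp
      ring
    linarith
  rcases hε1.eq_or_lt with rfl | hε1
  · have hEA : E ≤ᵐ[μpr] A := by
      filter_upwards [hdistinct, hpos] with ω hinj hω hωE
      refine hover ω hinj hω ?_
      obtain ⟨x, hx, hxk⟩ := kthSmallest_mem_image S _ hinj hk1 hkn
      have hkpos : 0 < kthSmallest S (fun x => h x ω) k := hxk ▸ hω x hx
      have hquot : 0 < k / kthSmallest S (fun x => h x ω) k := by positivity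
      rcases lt_abs.1 (show 1 * n < |_| from hωE) with hlt | hlt
      · exact hlt
      · linarith
    refine (measure_mono_ae hEA).trans (hA.trans_eq ?_)
    norm_num
  have hε2 : 0 < 1 - ε := by linarith
  set B : Set Ω := {ω | k * ε / (1 - ε) ≤
    |((S.filter fun x => h x ω ≤ k / ((1 - ε) * n)).card : ℝ) - n * (k / ((1 - ε) * n))|}
    with hB_def
  have hB : μpr B ≤ ENNReal.ofReal ((1 - ε) / (k * ε ^ 2)) := by
    refine (measure_le_abs_card_filter_sub_le μpr S h hmeas hunif hindep
      (by positivity) hp (by positivity)).trans_eq ?_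
    congr 1
    rw [← hn_def]
    field_simp
  have hunder : ∀ ω, Set.InjOn (fun x => h x ω) S → (∀ x ∈ S, 0 < h x ω) →
      ε * n < -(k / kthSmallest S (fun x => h x ω) k - n) → ω ∈ B := fun ω hinj hω hlt => by
    obtain ⟨x, hx, hxk⟩ := kthSmallest_mem_image S _ hinj hk1 hkn
    have hkpos : 0 < kthSmallest S (fun x => h x ω) k := hxk ▸ hω x hx
    have hgt : k / ((1 - ε) * n) < kthSmallest S (fun x => h x ω) k := by
      rw [div_lt_iff₀ (by positivity)]
      have : k / kthSmallest S (fun x => h x ω) k < (1 - ε) * n := by linarith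
      rw [div_lt_iff₀ hkpos] at this
      linarith
    have hcount : ((S.filter fun x => h x ω ≤ k / ((1 - ε) * n)).card : ℝ) < k := by
      exact_mod_cast not_le.1 fun hle =>
        hgt.not_ge ((kthSmallest_le_iff S _ hinj hk1 hkn _).2 hle)
    rw [hB_def, Set.mem_ofPred_eq]
    refine le_trans ?_ (neg_le_abs _)
    have : (k : ℝ) * ε / (1 - ε) = n * (k / ((1 - ε) * n)) - k := by
      field_simp
      ring
    linarith
  have hEAB : E ≤ᵐ[μpr] (A ∪ B : Set Ω) := by
    filter_upwards [hdistinct, hpos] with ω hinj hω hωE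
    rcases lt_abs.1 (show ε * n < |_| from hωE) with hlt | hlt
    · exact Or.inl (hover ω hinj hω hlt)
    · exact Or.inr (hunder ω hinj hω hlt)
  calc μpr E ≤ μpr A + μpr B := (measure_mono_ae hEAB).trans (measure_union_le A B)
    _ ≤ ENNReal.ofReal ((1 + ε) / (k * ε ^ 2)) + ENNReal.ofReal ((1 - ε) / (k * ε ^ 2)) :=
      add_le_add hA hB
    _ = ENNReal.ofReal (2 / (k * ε ^ 2)) := by
      rw [← ENNReal.ofReal_add (by positivity) (by positivity)]
      congr 1
      ring
end

section
/- Let u be a positive integer, let S ⊆ [u] with |S| ≤ u, and let h be a random function from S to [0,1). For p ∈ [0,1) write X^{<p} = |{x ∈ S : h(x) < p}| and μ_p = p·|S|. Suppose there are constants c > 0 and E ≥ 0 such that for every p ∈ [0,1) that is a multiple of 1/u and every 0 < ε ≤ 1, Pr[|X^{<p} − μ_p| ≥ ε·μ_p] ≤ 2·exp(−c·ε²·μ_p) + E. Then there exist constants c' > 0 and C ≥ 2 depending only on c such that for EVERY p ∈ [0,1) and every 0 < ε ≤ 1, Pr[|X^{<p} − μ_p| ≥ ε·μ_p] ≤ C·exp(−c'·ε²·μ_p)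 + C·E. -/
open MeasureTheory ProbabilityTheory

universe u_1 u_2

/-- If the upper deviation holds at `m` and `X ≤ Y`, where the mean at `Y` exceeds `m` by at most
one, then `Y` deviates by half the relative amount. -/
theorem half_deviation_of_upper {ε m m' X Y : ℝ} (hε1 : ε ≤ 1) (hm : 4 < ε * m) (hε : 0 < ε)
    (hm' : m' ≤ m + 1) (hXY : X ≤ Y) (hX : ε * m ≤ X - m) : ε / 2 * m' ≤ |Y - m'| := by
  refine le_trans ?_ (le_abs_self _)
  nlinarith [mul_le_mul_of_nonneg_left hm' hε.le]

/-- If the lower deviation holds at `m` and `Y ≤ X`, where the mean `m'` at `Y` lies in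
`[m - 1, m]`, then `Y` deviates by half the relative amount. -/
theorem half_deviation_of_lower {ε m m' X Y : ℝ} (hm : 4 < ε * m) (hε : 0 < ε)
    (hle : m' ≤ m) (hm' : m ≤ m' + 1) (hYX : Y ≤ X) (hX : ε * m ≤ m - X) :
    ε / 2 * m' ≤ |Y - m'| := by
  refine le_trans ?_ (neg_le_abs _)
  nlinarith [mul_le_mul_of_nonneg_left hle hε.le]

/-- The number of elements with value below the threshold is monotone in the threshold. -/
theorem card_filter_lt_mono {α : Type*} (S : Finset α) (f : α → ℝ) {a b : ℝ} (hab : a ≤ b) :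
    ((S.filter fun x => f x < a).card : ℝ) ≤ ((S.filter fun x => f x < b).card : ℝ) := by
  exact_mod_cast Finset.card_le_card
    (Finset.monotone_filter_right S fun _ _ hx => lt_of_lt_of_le hx hab)

/-- Suppose a random hash function `h` on `S ⊆ [u]` (`|S| ≤ u`) with
values in `[0,1)` satisfies, for every threshold `p ∈ [0,1)` that is a multiple of `1/u`
and every `0 < ε ≤ 1`, `Pr[|X^{<p} − μ_p| ≥ ε·μ_p] ≤ 2·exp(−c·ε²·μ_p) + E`, where
`X^{<p}` counts elements of `S` hashing below `p` and `μ_p = p·|S|`.  Then there are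
constants `c' > 0` and `C ≥ 2` depending only on `c` such that the same concentration
(with constants `c'`, `C`) holds for **every** `p ∈ [0,1)` and every `0 < ε ≤ 1`. -/
theorem stmt_11 (c : ℝ) (hc : 0 < c) :
    ∃ c' : ℝ, 0 < c' ∧ ∃ C : ℝ, 2 ≤ C ∧
      ∀ (Ω : Type u_1) (_ : MeasurableSpace Ω) (μpr : Measure Ω), IsProbabilityMeasure μpr →
      ∀ (α : Type u_2) (S : Finset α) (u : ℕ), 0 < u → S.card ≤ u →
      ∀ (h : α → Ω → ℝ), (∀ x ∈ S, ∀ ω, h x ω ∈ Set.Ico (0 : ℝ) 1) →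
      ∀ E : ℝ, 0 ≤ E →
      (∀ i : ℕ, (i : ℝ) / u < 1 → ∀ ε : ℝ, 0 < ε → ε ≤ 1 →
        μpr {ω | ε * ((i : ℝ) / u * S.card) ≤
            |((S.filter fun x => h x ω < (i : ℝ) / u).card : ℝ) - (i : ℝ) / u * S.card|} ≤
          ENNReal.ofReal (2 * Real.exp (-(c * ε ^ 2 * ((i : ℝ) / u * S.card))) + E)) →
      ∀ p : ℝ, 0 ≤ p → p < 1 → ∀ ε : ℝ, 0 < ε → ε ≤ 1 →
        μpr {ω | ε * (p * S.card) ≤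
            |((S.filter fun x => h x ω < p).card : ℝ) - p * S.card|} ≤
          ENNReal.ofReal (C * Real.exp (-(c' * ε ^ 2 * (p * S.card))) + C * E) := by
  refine ⟨c / 8, by positivity, 4 + Real.exp (c / 2), by linarith [Real.exp_pos (c / 2)], ?_⟩
  intro Ω _ μ _ α S u hu hSu h hh E hE H p hp0 hp1 ε hε hε1
  have hn : (0 : ℝ) ≤ S.card := Nat.cast_nonneg _
  have hu' : (0 : ℝ) < u := Nat.cast_pos.2 hu
  have hm0 : 0 ≤ p * S.card := by positivity
  rcases le_or_gt (ε ^ 2 * (p * S.card)) 4 with hsmall | hlarge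
  · refine prob_le_one.trans ?_
    rw [← ENNReal.ofReal_one]
    apply ENNReal.ofReal_le_ofReal
    have h1 : 1 ≤ Real.exp (c / 2) * Real.exp (-(c / 8 * ε ^ 2 * (p * S.card))) := by
      rw [← Real.exp_add]
      exact Real.one_le_exp (by nlinarith)
    have h2 := Real.exp_pos (-(c / 8 * ε ^ 2 * (p * S.card)))
    have h3 : 0 ≤ (4 + Real.exp (c / 2)) * E := by positivity
    nlinarith
  have hεm : 4 < ε * (p * S.card) := by
    nlinarith [mul_le_mul_of_nonneg_right hε1 (mul_nonneg hε.le hm0)]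
  have hm4 : 4 < p * S.card := by nlinarith
  obtain ⟨i, hi1, hi2⟩ : ∃ i : ℕ, (i : ℝ) / u ≤ p ∧ p < ((i + 1 : ℕ) : ℝ) / u := by
    refine ⟨⌊p * u⌋₊, ?_, ?_⟩
    · rw [div_le_iff₀ hu']
      exact Nat.floor_le (by positivity)
    · rw [lt_div_iff₀ hu']
      push_cast
      exact Nat.lt_floor_add_one _
  have hiu : i < u := by
    have := (div_lt_one hu').1 (hi1.trans_lt hp1)
    exact_mod_cast this
  have hstep : ((i + 1 : ℕ) : ℝ) / u * S.card ≤ (i : ℝ) / u * S.card + 1 := by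
    have h1 : (S.card : ℝ) / u ≤ 1 := by
      rw [div_le_one hu']
      exact_mod_cast hSu
    have h2 : ((i + 1 : ℕ) : ℝ) / u * S.card = (i : ℝ) / u * S.card + S.card / u := by
      push_cast
      ring
    linarith
  have hlo := mul_le_mul_of_nonneg_right hi1 hn
  have hhi := mul_le_mul_of_nonneg_right hi2.le hn
  set dev : ℕ → Set Ω := fun j => {ω | ε / 2 * ((j : ℝ) / u * S.card) ≤
    |((S.filter fun x => h x ω < (j : ℝ) / u).card : ℝ) - (j : ℝ) / u * S.card|} with hdev
  have hsub : {ω | ε * (p * S.card) ≤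
      |((S.filter fun x => h x ω < p).card : ℝ) - p * S.card|} ⊆ dev i ∪ dev (i + 1) := by
    intro ω hω
    rw [Set.mem_ofPred_eq] at hω
    rcases le_abs.1 hω with hX | hX
    · exact Or.inr (half_deviation_of_upper hε1 hεm hε (by linarith)
        (card_filter_lt_mono S (fun x => h x ω) hi2.le) hX)
    · exact Or.inl (half_deviation_of_lower hεm hε hlo (by linarith)
        (card_filter_lt_mono S (fun x => h x ω) hi1) (by linarith))
  have hbound : ∀ j : ℕ, j ≤ u → p * S.card - 1 ≤ (j : ℝ) / u * S.card → μ (dev j) ≤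
      ENNReal.ofReal (2 * Real.exp (-(c / 8 * ε ^ 2 * (p * S.card))) + E) := by
    intro j hju hj
    rcases lt_or_ge ((j : ℝ) / u) 1 with hj1 | hj1
    · refine (H j hj1 (ε / 2) (by positivity) (by linarith)).trans
        (ENNReal.ofReal_le_ofReal ?_)
      have : c / 8 * ε ^ 2 * (p * S.card) ≤ c * (ε / 2) ^ 2 * ((j : ℝ) / u * S.card) := by
        have h1 : p * S.card / 2 ≤ (j : ℝ) / u * S.card := by linarith
        have h2 := mul_le_mul_of_nonneg_left h1 (by positivity : 0 ≤ c * (ε / 2) ^ 2)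
        linarith
      gcongr
    · have hj1' : (j : ℝ) / u = 1 :=
        le_antisymm ((div_le_one hu').2 (by exact_mod_cast hju)) hj1
      have hempty : dev j = ∅ := by
        refine Set.eq_empty_of_forall_notMem fun ω hω => ?_
        simp only [hdev, Set.mem_ofPred_eq, hj1', one_mul] at hω hj
        rw [Finset.filter_true_of_mem fun x hx => (hh x hx ω).2, sub_self, abs_zero] at hω
        nlinarith
      simp [hempty]
  refine (measure_mono hsub).trans ((measure_union_le _ _).trans ?_)
  refine (add_le_add (hbound i hiu.le (by linarith)) (hbound (i + 1) hiu (by linarith))).trans ?_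
  rw [← ENNReal.ofReal_add (by positivity) (by positivity)]
  apply ENNReal.ofReal_le_ofReal
  have h2 := Real.exp_pos (-(c / 8 * ε ^ 2 * (p * S.card)))
  nlinarith [mul_nonneg (Real.exp_pos (c / 2)).le hE, mul_pos (Real.exp_pos (c / 2)) h2]
end

section
/- Let u be a positive integer, S a set with |S| ≤ u, and h : S → [0,1) any function. Fix p ∈ (0,1) and let p₊ = i/u be the smallest multiple of 1/u with p ≤ p₊, and p₋ = (i−1)/u. For q ∈ [0,1) write X^{<q} = |{x ∈ S : h(x) < q}| and μ_q = q·|S|. Suppose 0 < ε ≤ 1 and ε²·μ_p ≥ 3. If X^{<p} ≤ (1−ε)·μ_p, then X^{<p₋} ≤ (1−ε/2)·μ_{p₋}. -/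
/-- Let `|S| ≤ u`, `h : S → [0,1)` any function, `p ∈ (0,1)`, and let
`p₊ = i/u` be the smallest multiple of `1/u` with `p ≤ i/u`, `p₋ = (i−1)/u`.  Write
`X^{<q}` for the number of `x ∈ S` with `h x < q` and `μ_q = q·|S|`.  If `0 < ε ≤ 1`,
`ε²·μ_p ≥ 3` and `X^{<p} ≤ (1−ε)·μ_p`, then `X^{<p₋} ≤ (1−ε/2)·μ_{p₋}`. -/
theorem stmt_12 {α : Type*} (S : Finset α) (h : α → ℝ) (u : ℕ) (hu : 0 < u)
    (hSu : S.card ≤ u)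
    (hrange : ∀ x ∈ S, h x ∈ Set.Ico (0 : ℝ) 1)
    (p : ℝ) (hp0 : 0 < p) (hp1 : p < 1)
    (i : ℕ) (hple : p ≤ (i : ℝ) / u) (hmin : ((i : ℝ) - 1) / u < p)
    (ε : ℝ) (hε0 : 0 < ε) (hε1 : ε ≤ 1)
    (hbig : 3 ≤ ε ^ 2 * (p * S.card))
    (hdev : ((S.filter fun x => h x < p).card : ℝ) ≤ (1 - ε) * (p * S.card)) :
    ((S.filter fun x => h x < ((i : ℝ) - 1) / u).card : ℝ) ≤
      (1 - ε / 2) * (((i : ℝ) - 1) / u * S.card) := by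
  have hu' : (0 : ℝ) < u := by exact_mod_cast hu
  have hcard : ((S.filter fun x => h x < ((i : ℝ) - 1) / u).card : ℝ) ≤
      (S.filter fun x => h x < p).card := by
    exact_mod_cast Finset.card_le_card
      (Finset.monotone_filter_right S fun x _ hx => lt_trans hx hmin)
  have hμ : p * S.card - 1 ≤ ((i : ℝ) - 1) / u * S.card := by
    have hS : (S.card : ℝ) / u ≤ 1 := (div_le_one hu').2 (by exact_mod_cast hSu)
    have hmul := mul_le_mul_of_nonneg_right hple (Nat.cast_nonneg (α := ℝ) S.card)
    have hsplit : ((i : ℝ) - 1) / u * S.card = (i : ℝ) / u * S.card - S.card / u := by ring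
    linarith
  have hεμ : 3 ≤ ε * (p * S.card) := by
    have hμ0 : 0 ≤ p * (S.card : ℝ) := by positivity
    nlinarith [mul_le_mul_of_nonneg_right hε1 (mul_nonneg hε0.le hμ0)]
  have hscaled := mul_le_mul_of_nonneg_left hμ (by linarith : 0 ≤ 1 - ε / 2)
  linarith
end

section
/- Let u be a positive integer, S a set with |S| ≤ u, and h : S → [0,1) any function. Fix p ∈ (0,1) and let p₊ = i/u be the smallest multiple of 1/u with p ≤ p₊. For q ∈ [0,1] write X^{<q} = |{x ∈ S : h(x) < q}| and μ_q = q·|S|. Suppose 0 < ε ≤ 1 and ε²·μ_p ≥ 3. If X^{<p} ≥ (1+ε)·μ_p, then X^{<p₊} ≥ (1+ε/2)·μ_{p₊}. -/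
/-- Let `|S| ≤ u`, `h : S → [0,1)` any function, `p ∈ (0,1)`, and let
`p₊ = i/u` be the smallest multiple of `1/u` with `p ≤ i/u`.  Write `X^{<q}` for the
number of `x ∈ S` with `h x < q` and `μ_q = q·|S|`.  If `0 < ε ≤ 1`, `ε²·μ_p ≥ 3` and
`X^{<p} ≥ (1+ε)·μ_p`, then `X^{<p₊} ≥ (1+ε/2)·μ_{p₊}`. -/
theorem stmt_13 {α : Type*} (S : Finset α) (h : α → ℝ) (u : ℕ) (hu : 0 < u)
    (hSu : S.card ≤ u)
    (hrange : ∀ x ∈ S, h x ∈ Set.Ico (0 : ℝ) 1)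
    (p : ℝ) (hp0 : 0 < p) (hp1 : p < 1)
    (i : ℕ) (hple : p ≤ (i : ℝ) / u) (hmin : ((i : ℝ) - 1) / u < p)
    (ε : ℝ) (hε0 : 0 < ε) (hε1 : ε ≤ 1)
    (hbig : 3 ≤ ε ^ 2 * (p * S.card))
    (hdev : (1 + ε) * (p * S.card) ≤ ((S.filter fun x => h x < p).card : ℝ)) :
    (1 + ε / 2) * ((i : ℝ) / u * S.card) ≤
      ((S.filter fun x => h x < (i : ℝ) / u).card : ℝ) := by
  have hu' : (0 : ℝ) < u := by exact_mod_cast hu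
  have hSu' : (S.card : ℝ) ≤ u := by exact_mod_cast hSu
  have hmono : ((S.filter fun x => h x < p).card : ℝ) ≤
      ((S.filter fun x => h x < (i : ℝ) / u).card : ℝ) := by
    exact_mod_cast Finset.card_le_card
      (Finset.monotone_filter_right S fun x _ hx => lt_of_lt_of_le hx hple)
  have hmean : (i : ℝ) / u * S.card ≤ p * S.card + 1 := by
    have hstep : (i : ℝ) / u ≤ p + 1 / u := by
      rw [sub_div] at hmin
      linarith
    have hinv : 1 / (u : ℝ) * S.card ≤ 1 := by
      rw [one_div_mul_eq_div]
      exact div_le_one_of_le₀ hSu' hu'.le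
    calc (i : ℝ) / u * S.card ≤ (p + 1 / u) * S.card := by gcongr
      _ ≤ p * S.card + 1 := by linarith
  have hlin : 3 ≤ ε * (p * S.card) := by
    refine hbig.trans (mul_le_mul_of_nonneg_right ?_ (by positivity))
    nlinarith
  calc (1 + ε / 2) * ((i : ℝ) / u * S.card)
      ≤ (1 + ε / 2) * (p * S.card + 1) := by gcongr
    _ ≤ (1 + ε) * (p * S.card) := by linarith
    _ ≤ _ := hdev.trans hmono
end

section
/- Let S be a finite set of size n with a subset T ⊆ S of size f·n (so f = |T|/|S|), let h be a random injection from S into (0,1], and let 1 ≤ k ≤ n. Let h_(k) be the k-th smallest hash value of S and for p ∈ (0,1] let Y^{≤p} = |{x ∈ T : h(x) ≤ p}| and X^{<p} = |{x ∈ S : h(x) < p}|. Suppose there are constants c > 0 and E ≥ 0 such that for every p, every subset of S, and every 0 < ε ≤ 1, the number of elements of that subset hashing below (or at most) p deviates from its mean p·(size) by a factor ε with probability at most 2·exp(−c·ε²·p·(size)) + E. Then there exist constants C ≥ 2 and c' > 0 depending only on c such that for every 0 < ε ≤ 1 (with k/((1−ε/3)n) ≤ 1), Pr[|Y^{≤ h_(k)}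 − f·k| > ε·f·k] ≤ C·exp(−c'·f·k·ε²) + C·E. -/
open MeasureTheory ProbabilityTheory

universe u_1 u_2

/-- On `S`, exactly `k` values of an injective function are at most its `k`-th smallest value,
and fewer than `k` are below it. -/
theorem card_filter_kthSmallest {α : Type*} (S : Finset α) (h : α → ℝ) (hinj : Set.InjOn h S)
    (k : ℕ) (hk : 1 ≤ k) (hkS : k ≤ S.card) :
    (S.filter fun x => h x ≤ kthSmallest S h k).card = k ∧
      (S.filter fun x => h x < kthSmallest S h k).card < k := by
  classical
  have hcard : (S.image h).card = S.card := Finset.card_image_of_injOn hinj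
  set e := (S.image h).orderEmbOfFin hcard with he
  let i : Fin S.card := ⟨k - 1, by omega⟩
  have hτ : kthSmallest S h k = e i := by
    rw [he, Finset.orderEmbOfFin_apply, kthSmallest, List.getD_eq_getElem]
    rfl
  have hfilter : ∀ P : ℝ → Prop, ∀ _ : DecidablePred P,
      (S.filter fun x => P (h x)).card = (Finset.univ.filter fun j => P (e j)).card := by
    intro P _
    have h1 : (S.filter fun x => P (h x)).card = ((S.image h).filter P).card := by
      rw [Finset.filter_image, Finset.card_image_of_injOn]
      exact hinj.mono fun x hx => (Finset.mem_filter.mp hx).1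
    rw [h1, ← Finset.image_orderEmbOfFin_univ (S.image h) hcard, Finset.filter_image,
      Finset.card_image_of_injective _ e.injective]
  rw [hτ]
  constructor
  · rw [hfilter (fun y => y ≤ e i) inferInstance]
    have : (Finset.univ.filter fun j => e j ≤ e i) = Finset.Iic i := by ext; simp
    rw [this, Fin.card_Iic]
    simp only [i]
    omega
  · rw [hfilter (fun y => y < e i) inferInstance]
    have : (Finset.univ.filter fun j => e j < e i) = Finset.Iio i := by ext; simp
    rw [this, Fin.card_Iio]
    simp only [i]
    omega

/-- A relative deviation of more than `ε` of the bottom-`k` count from its mean forces a relative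
deviation of at least `ε / 3` of one of four counts below a fixed threshold. -/
theorem exists_threshold_deviation {α : Type*} {S T : Finset α} (h : α → ℝ)
    (hinj : Set.InjOn h S) {k : ℕ} (hk : 1 ≤ k) (hkS : k ≤ S.card) {ε : ℝ} (hε : 0 < ε)
    (hε1 : ε ≤ 1) {p q : ℝ} (hp : (1 + ε / 3) * (p * S.card) = k)
    (hq : (1 - ε / 3) * (q * S.card) = k)
    (hdev : ε * ((T.card : ℝ) / S.card * k) <
      |((T.filter fun x => h x ≤ kthSmallest S h k).card : ℝ) - (T.card : ℝ) / S.card * k|) :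
    (ε / 3 * (p * S.card) ≤ |((S.filter fun x => h x < p).card : ℝ) - p * S.card| ∨
      ε / 3 * (q * S.card) ≤ |((S.filter fun x => h x ≤ q).card : ℝ) - q * S.card|) ∨
    (ε / 3 * (p * T.card) ≤ |((T.filter fun x => h x ≤ p).card : ℝ) - p * T.card| ∨
      ε / 3 * (q * T.card) ≤ |((T.filter fun x => h x ≤ q).card : ℝ) - q * T.card|) := by
  obtain ⟨hle, hlt⟩ := card_filter_kthSmallest S h hinj k hk hkS
  set τ := kthSmallest S h k
  have hS : (0 : ℝ) < S.card := by exact_mod_cast (by omega : 0 < S.card)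
  have hk0 : (0 : ℝ) < k := by exact_mod_cast hk
  have hp0 : 0 ≤ p := by
    by_contra! hneg
    nlinarith [mul_neg_of_neg_of_pos hneg hS]
  have hq0 : 0 ≤ q := by
    by_contra! hneg
    nlinarith [mul_neg_of_neg_of_pos hneg hS]
  have hpT : (T.card : ℝ) / S.card * k = (1 + ε / 3) * (p * T.card) := by
    rw [← hp]; field_simp
  have hqT : (T.card : ℝ) / S.card * k = (1 - ε / 3) * (q * T.card) := by
    rw [← hq]; field_simp
  have hpT0 : 0 ≤ p * T.card := by positivity
  have hqT0 : 0 ≤ q * T.card := by positivity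
  rcases lt_abs.mp hdev with hup | hlow
  · by_cases hτ : τ ≤ q
    · right; right
      have hmono : ((T.filter fun x => h x ≤ τ).card : ℝ) ≤ (T.filter fun x => h x ≤ q).card := by
        exact_mod_cast Finset.card_le_card
          (Finset.monotone_filter_right T fun x _ hx => le_trans hx hτ)
      rw [hqT] at hup
      refine le_trans ?_ (le_abs_self _)
      nlinarith [mul_nonneg (mul_nonneg hε.le (sub_nonneg.mpr hε1)) hqT0]
    · left; right
      have hmono : ((S.filter fun x => h x ≤ q).card : ℝ) ≤ k := by
        exact_mod_cast (Finset.card_le_card (Finset.monotone_filter_right S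
          fun x _ hx => lt_of_le_of_lt hx (not_le.mp hτ))).trans hlt.le
      refine le_trans ?_ (neg_le_abs _)
      linarith
  · by_cases hτ : τ < p
    · left; left
      have hmono : (k : ℝ) ≤ (S.filter fun x => h x < p).card := by
        exact_mod_cast hle.ge.trans (Finset.card_le_card (Finset.monotone_filter_right S
          fun x _ hx => lt_of_le_of_lt hx hτ))
      refine le_trans ?_ (le_abs_self _)
      linarith
    · right; left
      have hmono : ((T.filter fun x => h x ≤ p).card : ℝ) ≤ (T.filter fun x => h x ≤ τ).card := by
        exact_mod_cast Finset.card_le_card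
          (Finset.monotone_filter_right T fun x _ hx => le_trans hx (not_lt.mp hτ))
      rw [hpT] at hlow
      refine le_trans ?_ (neg_le_abs _)
      nlinarith [mul_nonneg (mul_nonneg hε.le hε.le) hpT0, mul_nonneg hε.le hpT0]

/-- There are constants `C ≥ 2` and `c' > 0`, depending only on `c`,
with the following property.  Let `T ⊆ S`, `|S| = n`, `f = |T|/|S|`, let `h` be a random
injection of `S` into `(0,1]` that is `(c,E)`-strongly concentrated: for every subset
`R ⊆ S`, every `p ∈ (0,1]` and every `0 < ε ≤ 1`, the number of elements of `R` hashing
below (resp. at most) `p` deviates from `p·|R|` by `ε·p·|R|` with probability at most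
`2·exp(−c·ε²·p·|R|) + E`.  Then for `1 ≤ k ≤ n` and every `0 < ε ≤ 1` with
`k/((1−ε/3)n) ≤ 1`, the bottom-`k` similarity estimator satisfies
`Pr[|Y^{≤h_(k)} − f·k| > ε·f·k] ≤ C·exp(−c'·f·k·ε²) + C·E`. -/
theorem stmt_14 (c : ℝ) (hc : 0 < c) :
    ∃ C : ℝ, 2 ≤ C ∧ ∃ c' : ℝ, 0 < c' ∧
      ∀ (Ω : Type u_1) (_ : MeasurableSpace Ω) (μpr : Measure Ω), IsProbabilityMeasure μpr →
      ∀ (α : Type) (S T : Finset α), T ⊆ S →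
      ∀ (h : α → Ω → ℝ),
        (∀ ω, Set.InjOn (fun x => h x ω) S) →
        (∀ ω, ∀ x ∈ S, h x ω ∈ Set.Ioc (0 : ℝ) 1) →
      ∀ E : ℝ, 0 ≤ E →
      (∀ R : Finset α, R ⊆ S → ∀ p : ℝ, p ∈ Set.Ioc (0 : ℝ) 1 →
        ∀ ε : ℝ, 0 < ε → ε ≤ 1 →
          μpr {ω | ε * (p * R.card) ≤
              |((R.filter fun x => h x ω < p).card : ℝ) - p * R.card|} ≤
            ENNReal.ofReal (2 * Real.exp (-(c * ε ^ 2 * (p * R.card))) + E) ∧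
          μpr {ω | ε * (p * R.card) ≤
              |((R.filter fun x => h x ω ≤ p).card : ℝ) - p * R.card|} ≤
            ENNReal.ofReal (2 * Real.exp (-(c * ε ^ 2 * (p * R.card))) + E)) →
      ∀ k : ℕ, 1 ≤ k → k ≤ S.card →
      ∀ ε : ℝ, 0 < ε → ε ≤ 1 → (k : ℝ) / ((1 - ε / 3) * S.card) ≤ 1 →
        μpr {ω | ε * ((T.card : ℝ) / S.card * k) <
            |((T.filter fun x =>
                h x ω ≤ kthSmallest S (fun y => h y ω) k).card : ℝ) -
              (T.card : ℝ) / S.card * k|} ≤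
          ENNReal.ofReal
            (C * Real.exp (-(c' * ((T.card : ℝ) / S.card * k) * ε ^ 2)) + C * E) := by
  refine ⟨8, by norm_num, c / 12, by positivity, ?_⟩
  intro Ω _ μ _ α S T hTS h hinj _ E hE hconc k hk hkS ε hε hε1 hkε
  have hS : (0 : ℝ) < S.card := by exact_mod_cast (by omega : 0 < S.card)
  have hk0 : (0 : ℝ) < k := by exact_mod_cast hk
  have hkS' : (k : ℝ) ≤ S.card := by exact_mod_cast hkS
  have hT : (T.card : ℝ) ≤ S.card := by exact_mod_cast Finset.card_le_card hTS
  have ha : 0 < 1 + ε / 3 := by positivity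
  have hb : 0 < 1 - ε / 3 := by linarith
  set p : ℝ := k / ((1 + ε / 3) * S.card) with hp_def
  set q : ℝ := k / ((1 - ε / 3) * S.card) with hq_def
  have hp : (1 + ε / 3) * (p * S.card) = k := by rw [hp_def]; field_simp
  have hq : (1 - ε / 3) * (q * S.card) = k := by
    rw [hq_def, mul_comm _ (S.card : ℝ), ← mul_assoc, mul_comm]
    exact div_mul_cancel₀ _ (by positivity)
  have hp0 : 0 < p := by positivity
  have hq0 : 0 < q := by positivity
  have hp1 : p ≤ 1 := by
    rw [hp_def, div_le_one (by positivity)]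
    nlinarith
  set m : ℝ := (T.card : ℝ) / S.card * k with hm_def
  have hm0 : 0 ≤ m := by positivity
  have hmk : m ≤ k := mul_le_of_le_one_left hk0.le ((div_le_one hS).mpr hT)
  have hpT : m = (1 + ε / 3) * (p * T.card) := by
    rw [hm_def, ← hp]; field_simp
  have hqT : m = (1 - ε / 3) * (q * T.card) := by
    rw [hm_def, ← hq]; field_simp
  set B : ℝ := 2 * Real.exp (-(c / 12 * m * ε ^ 2)) + E with hB_def
  have hB0 : 0 ≤ B := by positivity
  have hbound : ∀ M : ℝ, 3 / 4 * m ≤ M →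
      ENNReal.ofReal (2 * Real.exp (-(c * (ε / 3) ^ 2 * M)) + E) ≤ ENNReal.ofReal B := by
    intro M hM
    apply ENNReal.ofReal_le_ofReal
    rw [hB_def]
    have := mul_le_mul_of_nonneg_left hM (by positivity : 0 ≤ c * (ε / 3) ^ 2)
    have : Real.exp (-(c * (ε / 3) ^ 2 * M)) ≤ Real.exp (-(c / 12 * m * ε ^ 2)) :=
      Real.exp_le_exp.mpr (by linarith)
    linarith
  have hε3 : 0 < ε / 3 := by positivity
  have hε31 : ε / 3 ≤ 1 := by linarith
  have hpT0 : 0 ≤ p * T.card := by positivity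
  have hqT0 : 0 ≤ q * T.card := by positivity
  have hpS0 : 0 ≤ p * S.card := by positivity
  have hqS0 : 0 ≤ q * S.card := by positivity
  have hple : ∀ x : ℝ, 0 ≤ x → m ≤ (1 + ε / 3) * x → 3 / 4 * m ≤ x := by
    intro x hx hmx
    linarith [mul_le_mul_of_nonneg_right hε1 hx]
  have hqle : ∀ x : ℝ, 0 ≤ x → m ≤ (1 - ε / 3) * x → 3 / 4 * m ≤ x := by
    intro x hx hmx
    linarith [mul_nonneg hε.le hx]
  have h1 := (hconc S subset_rfl p ⟨hp0, hp1⟩ _ hε3 hε31).1.trans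
    (hbound _ (hple _ hpS0 (hp.symm ▸ hmk)))
  have h2 := (hconc S subset_rfl q ⟨hq0, hkε⟩ _ hε3 hε31).2.trans
    (hbound _ (hqle _ hqS0 (hq.symm ▸ hmk)))
  have h3 := (hconc T hTS p ⟨hp0, hp1⟩ _ hε3 hε31).2.trans
    (hbound _ (hple _ hpT0 hpT.le))
  have h4 := (hconc T hTS q ⟨hq0, hkε⟩ _ hε3 hε31).2.trans
    (hbound _ (hqle _ hqT0 hqT.le))
  refine (measure_mono fun ω hω =>
    exists_threshold_deviation (fun x => h x ω) (hinj ω) hk hkS hε hε1 hp hq hω).trans ?_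
  calc _ ≤ (ENNReal.ofReal B + ENNReal.ofReal B) + (ENNReal.ofReal B + ENNReal.ofReal B) :=
        (measure_union_le _ _).trans (add_le_add
          ((measure_union_le _ _).trans (add_le_add h1 h2))
          ((measure_union_le _ _).trans (add_le_add h3 h4)))
    _ = ENNReal.ofReal ((B + B) + (B + B)) := by
        rw [ENNReal.ofReal_add (add_nonneg hB0 hB0) (add_nonneg hB0 hB0),
          ENNReal.ofReal_add hB0 hB0]
    _ ≤ _ := by
        apply ENNReal.ofReal_le_ofReal
        rw [hB_def]
        linarith
end

section
/- Let A and B be finite subsets of a universe U and let h : U → (0,1] be injective on A ∪ B. For a finite set S ⊆ U with |S| ≥ k, let MIN_k(S) denote the set of the k elements of S with the smallest h-values. If |A| ≥ k and |B| ≥ k, then MIN_k(A ∪ B) = MIN_k(MIN_k(A) ∪ MIN_k(B)). -/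
/-- The bottom-`k` sample `MIN_k(S)`: the set of the `k` elements of `S` with the
smallest hash values (for `h` injective on `S` and `|S| ≥ k`), realized as the
elements whose hash value is at most the `k`-th smallest hash value of `S`. -/
noncomputable def MINk {α : Type*} (h : α → ℝ) (k : ℕ) (S : Finset α) : Finset α :=
  S.filter fun x => h x ≤ kthSmallest S h k

theorem Finset.card_filter_lt_orderEmbOfFin {α : Type*} [LinearOrder α] (T : Finset α) {n : ℕ}
    (hn : T.card = n) (i : Fin n) :
    (T.filter (· < T.orderEmbOfFin hn i)).card = i := by
  have himage : T.filter (· < T.orderEmbOfFin hn i) =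
      (Finset.Iio i).map (T.orderEmbOfFin hn).toEmbedding := by
    ext w
    simp only [Finset.mem_filter, Finset.mem_map, Finset.mem_Iio, RelEmbedding.coe_toEmbedding]
    constructor
    · rintro ⟨hw, hlt⟩
      rw [← Finset.mem_coe, ← Finset.range_orderEmbOfFin T hn] at hw
      obtain ⟨j, rfl⟩ := hw
      exact ⟨j, (T.orderEmbOfFin hn).lt_iff_lt.1 hlt, rfl⟩
    · rintro ⟨j, hj, rfl⟩
      exact ⟨Finset.orderEmbOfFin_mem T hn j, (T.orderEmbOfFin hn).lt_iff_lt.2 hj⟩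
  rw [himage, Finset.card_map, Fin.card_Iio]

/-- The `k`-th smallest hash value is attained, and exactly `k - 1` elements have a smaller one. -/
theorem exists_eq_kthSmallest {α : Type*} {S : Finset α} {h : α → ℝ} {k : ℕ}
    (hinj : Set.InjOn h S) (hk : k ≤ S.card) (hS : S.Nonempty) :
    ∃ z ∈ S, h z = kthSmallest S h k ∧ (S.filter fun y => h y < h z).card = k - 1 := by
  have hcard : (S.image h).card = S.card := Finset.card_image_of_injOn hinj
  have hi : k - 1 < S.card := by have := hS.card_pos; omega
  have hval : kthSmallest S h k = (S.image h).orderEmbOfFin hcard ⟨k - 1, hi⟩ := by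
    rw [kthSmallest, Finset.orderEmbOfFin_apply, List.getD_eq_getElem]
    rfl
  obtain ⟨z, hz, hzt⟩ := Finset.mem_image.1
    (Finset.orderEmbOfFin_mem (S.image h) hcard ⟨k - 1, hi⟩)
  refine ⟨z, hz, hzt.trans hval.symm, ?_⟩
  have hlt := Finset.card_filter_lt_orderEmbOfFin (S.image h) hcard ⟨k - 1, hi⟩
  rwa [← hzt, Finset.filter_image, Finset.card_image_of_injOn
    (hinj.mono (Finset.coe_subset.2 (Finset.filter_subset _ _)))] at hlt

theorem MINk_subset {α : Type*} (h : α → ℝ) (k : ℕ) (S : Finset α) : MINk h k S ⊆ S :=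
  Finset.filter_subset _ _

theorem lt_card_filter_le {α : Type*} {S : Finset α} {h : α → ℝ} {z : α} (hz : z ∈ S) :
    (S.filter fun y => h y < h z).card < (S.filter fun y => h y ≤ h z).card := by
  refine Finset.card_lt_card (Finset.ssubset_iff_of_subset ?_ |>.2 ⟨z, by simp [hz], by simp⟩)
  exact Finset.monotone_filter_right S fun y _ hy => le_of_lt hy

/-- An element belongs to the bottom-`k` sample iff at most `k - 1` elements have a smaller hash. -/
theorem mem_MINk_iff {α : Type*} {S : Finset α} {h : α → ℝ} {k : ℕ}
    (hinj : Set.InjOn h S) (hk : k ≤ S.card) {x : α} :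
    x ∈ MINk h k S ↔ x ∈ S ∧ (S.filter fun y => h y < h x).card ≤ k - 1 := by
  rw [MINk, Finset.mem_filter]
  refine and_congr_right fun hx => ?_
  obtain ⟨z, hz, hzt, hcard⟩ := exists_eq_kthSmallest hinj hk ⟨x, hx⟩
  rw [← hzt, ← hcard]
  constructor
  · intro hle
    exact Finset.card_le_card
      (Finset.monotone_filter_right S fun y _ hy => lt_of_lt_of_le hy hle)
  · contrapose!
    intro hlt
    exact (lt_card_filter_le hz).trans_le (Finset.card_le_card
      (Finset.monotone_filter_right S fun y _ hy => lt_of_le_of_lt hy hlt))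

theorem lt_card_MINk {α : Type*} {S : Finset α} {h : α → ℝ} {k : ℕ}
    (hinj : Set.InjOn h S) (hk : k ≤ S.card) (hS : S.Nonempty) :
    k - 1 < (MINk h k S).card := by
  obtain ⟨z, hz, hzt, hcard⟩ := exists_eq_kthSmallest hinj hk hS
  rw [MINk, ← hzt, ← hcard]
  exact lt_card_filter_le hz

theorem le_card_MINk {α : Type*} {S : Finset α} {h : α → ℝ} {k : ℕ}
    (hinj : Set.InjOn h S) (hk : k ≤ S.card) : k ≤ (MINk h k S).card := by
  rcases S.eq_empty_or_nonempty with rfl | hS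
  · simp_all
  · have := lt_card_MINk hinj hk hS
    omega

/-- If fewer than `k` elements of a superset `N` of the bottom-`k` sample of `S` have hash below
`h x`, then every element of `S` with hash below `h x` lies in the sample. -/
theorem mem_MINk_of_lt {α : Type*} {S N : Finset α} {h : α → ℝ} {k : ℕ}
    (hinj : Set.InjOn h S) (hk : k ≤ S.card) (hN : MINk h k S ⊆ N) {x y : α}
    (hx : (N.filter fun y => h y < h x).card ≤ k - 1) (hy : y ∈ S) (hyx : h y < h x) :
    y ∈ MINk h k S := by
  by_contra hnot
  have hty : kthSmallest S h k < h y := by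
    by_contra! hle
    exact hnot (Finset.mem_filter.2 ⟨hy, hle⟩)
  have hsub : MINk h k S ⊆ N.filter fun y => h y < h x := fun w hw =>
    Finset.mem_filter.2 ⟨hN hw, (Finset.mem_filter.1 hw).2.trans_lt (hty.trans hyx)⟩
  have := Finset.card_le_card hsub
  have := lt_card_MINk hinj hk ⟨y, hy⟩
  omega

/-- For `h : U → (0,1]` injective on `A ∪ B` with `|A| ≥ k` and
`|B| ≥ k`, the bottom-`k` sample of the union is the bottom-`k` sample of the union
of the bottom-`k` samples: `MIN_k(A ∪ B) = MIN_k(MIN_k(A) ∪ MIN_k(B))`. -/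
theorem stmt_17 {U : Type*} [DecidableEq U] (A B : Finset U) (h : U → ℝ)
    (hinj : Set.InjOn h (A ∪ B : Finset U))
    (hrange : ∀ x ∈ A ∪ B, h x ∈ Set.Ioc (0 : ℝ) 1)
    (k : ℕ) (hA : k ≤ A.card) (hB : k ≤ B.card) :
    MINk h k (A ∪ B) = MINk h k (MINk h k A ∪ MINk h k B) := by
  have hiA : Set.InjOn h A := hinj.mono (Finset.coe_subset.2 Finset.subset_union_left)
  have hiB : Set.InjOn h B := hinj.mono (Finset.coe_subset.2 Finset.subset_union_right)
  have hNsub : MINk h k A ∪ MINk h k B ⊆ A ∪ B :=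
    Finset.union_subset_union (MINk_subset h k A) (MINk_subset h k B)
  have hiN := hinj.mono (Finset.coe_subset.2 hNsub)
  have hkN : k ≤ (MINk h k A ∪ MINk h k B).card :=
    (le_card_MINk hiA hA).trans (Finset.card_le_card Finset.subset_union_left)
  have hkU : k ≤ (A ∪ B).card := hA.trans (Finset.card_le_card Finset.subset_union_left)
  ext x
  rw [mem_MINk_iff hinj hkU, mem_MINk_iff hiN hkN]
  constructor
  · rintro ⟨hx, hr⟩
    refine ⟨?_, (Finset.card_le_card (Finset.filter_subset_filter _ hNsub)).trans hr⟩
    rcases Finset.mem_union.1 hx with hx | hx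
    · exact Finset.mem_union_left _ ((mem_MINk_iff hiA hA).2 ⟨hx, (Finset.card_le_card
        (Finset.filter_subset_filter _ Finset.subset_union_left)).trans hr⟩)
    · exact Finset.mem_union_right _ ((mem_MINk_iff hiB hB).2 ⟨hx, (Finset.card_le_card
        (Finset.filter_subset_filter _ Finset.subset_union_right)).trans hr⟩)
  · rintro ⟨hx, hr⟩
    refine ⟨hNsub hx, le_trans (Finset.card_le_card fun y hy => ?_) hr⟩
    obtain ⟨hy, hyx⟩ := Finset.mem_filter.1 hy
    refine Finset.mem_filter.2 ⟨?_, hyx⟩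
    rcases Finset.mem_union.1 hy with hy | hy
    · exact Finset.mem_union_left _
        (mem_MINk_of_lt hiA hA Finset.subset_union_left hr hy hyx)
    · exact Finset.mem_union_right _
        (mem_MINk_of_lt hiB hB Finset.subset_union_right hr hy hyx)
end
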